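/- Bias of the four-query Hessian estimator: there exists a constant C, depending only on D₁, M, D₂ and κ, such that for all θ ∈ ℝ^d and all 0 < c̃ ≤ κ·c with 0 < c ≤ 1, the estimator Ĥ(θ) := (ℓ̄/(2·c·c̃)) · φ(Δ̃)·φ(Δ)ᵀ — where ℓ̄ := L(θ + cΔ + c̃Δ̃) − L(θ + cΔ) − L(θ − cΔ + c̃Δ̃) + L(θ − cΔ) plus observation noises whose conditional expectation given (Δ, Δ̃) is zero — satisfies ‖E[Ĥ(θ)] − ∇²L(θ)‖ ≤ C·c² (matrix operator norm). -/

import Mathlib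

open MeasureTheory Filter Topology

section Taylor

variable {E F : Type*} [NormedAddCommGroup E] [NormedSpace ℝ E]
  [NormedAddCommGroup F] [NormedSpace ℝ F]

theorem norm_le_mul_pow_of_norm_fderiv_le {f : E → F} (hf : Differentiable ℝ f) (h0 : f 0 = 0)
    {K : ℝ} (hK : 0 ≤ K) {n : ℕ} (hb : ∀ w, ‖fderiv ℝ f w‖ ≤ K * ‖w‖ ^ n) (w : E) :
    ‖f w‖ ≤ K * ‖w‖ ^ (n + 1) := by
  have h := (convex_closedBall (0 : E) ‖w‖).norm_image_sub_le_of_norm_fderiv_le (𝕜 := ℝ) (f := f)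
    (C := K * ‖w‖ ^ n) (x := 0) (y := w) (fun x _ => hf x)
    (fun x hx => (hb x).trans (by
      have : ‖x‖ ≤ ‖w‖ := by simpa using hx
      gcongr)) (by simp) (by simp)
  simpa [h0, pow_succ, mul_assoc] using h

theorem norm_le_mul_one_add_pow_of_norm_fderiv_le {f : E → F} (hf : Differentiable ℝ f)
    {K : ℝ} (hK : 0 ≤ K) {n : ℕ} (hb : ∀ w, ‖fderiv ℝ f w‖ ≤ K * (1 + ‖w‖) ^ n) (w : E) :
    ‖f w‖ ≤ (‖f 0‖ + K) * (1 + ‖w‖) ^ (n + 1) := by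
  have h := (convex_closedBall (0 : E) ‖w‖).norm_image_sub_le_of_norm_fderiv_le (𝕜 := ℝ) (f := f)
    (C := K * (1 + ‖w‖) ^ n) (x := 0) (y := w) (fun x _ => hf x)
    (fun x hx => (hb x).trans (by
      have : ‖x‖ ≤ ‖w‖ := by simpa using hx
      gcongr)) (by simp) (by simp)
  rw [sub_zero] at h
  have h1 : (1 : ℝ) ≤ (1 + ‖w‖) ^ (n + 1) := one_le_pow₀ (by linarith [norm_nonneg w])
  calc ‖f w‖ ≤ ‖f 0‖ + ‖f w - f 0‖ := by simpa using norm_add_le (f 0) (f w - f 0)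
    _ ≤ ‖f 0‖ * (1 + ‖w‖) ^ (n + 1) + K * (1 + ‖w‖) ^ n * (1 + ‖w‖) := by
        refine add_le_add (le_mul_of_one_le_right (norm_nonneg _) h1) (h.trans ?_)
        gcongr
        linarith
    _ = _ := by ring

set_option maxSynthPendingDepth 4 in
theorem norm_fderiv_three_eq_norm_iteratedFDeriv (f : E → F) (x : E) :
    ‖fderiv ℝ (fderiv ℝ (fderiv ℝ f)) x‖ = ‖iteratedFDeriv ℝ 3 f x‖ := by
  rw [← norm_iteratedFDeriv_fderiv, ← norm_iteratedFDeriv_fderiv, norm_iteratedFDeriv_one]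

theorem contDiff_two_fderiv {f : E → F} (hf : ContDiff ℝ 3 f) : ContDiff ℝ 2 (fderiv ℝ f) :=
  hf.fderiv_right (by norm_num)

theorem contDiff_one_fderiv_fderiv {f : E → F} (hf : ContDiff ℝ 3 f) :
    ContDiff ℝ 1 (fderiv ℝ (fderiv ℝ f)) :=
  (contDiff_two_fderiv hf).fderiv_right (by norm_num)

set_option maxSynthPendingDepth 4 in
theorem norm_fderiv_three_sub_eq {f : E → F} (hf : ContDiff ℝ 3 f) (x y : E) :
    ‖fderiv ℝ (fderiv ℝ (fderiv ℝ f)) x - fderiv ℝ (fderiv ℝ (fderiv ℝ f)) y‖ =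
      ‖iteratedFDeriv ℝ 3 f x - iteratedFDeriv ℝ 3 f y‖ := by
  have hadd : ∀ a : E, ContDiff ℝ 3 fun w => f (a + w) := fun a => by fun_prop
  have h1 := (hf.differentiable (by norm_num))
  have h2 := ((contDiff_two_fderiv hf).differentiable (by norm_num))
  have h3 := ((contDiff_one_fderiv_fderiv hf).differentiable (by norm_num))
  have e1 : fderiv ℝ (fun w => f (x + w) - f (y + w)) =
      fun w => fderiv ℝ f (x + w) - fderiv ℝ f (y + w) := by
    funext w
    rw [fderiv_fun_sub (by fun_prop) (by fun_prop), fderiv_comp_add_left, fderiv_comp_add_left]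
  have e2 : fderiv ℝ (fun w => fderiv ℝ f (x + w) - fderiv ℝ f (y + w)) =
      fun w => fderiv ℝ (fderiv ℝ f) (x + w) - fderiv ℝ (fderiv ℝ f) (y + w) := by
    funext w
    rw [fderiv_fun_sub (by fun_prop) (by fun_prop), fderiv_comp_add_left, fderiv_comp_add_left]
  have key := norm_fderiv_three_eq_norm_iteratedFDeriv (fun w => f (x + w) - f (y + w)) 0
  rw [e1, e2, fderiv_fun_sub (by fun_prop) (by fun_prop), fderiv_comp_add_left,
    fderiv_comp_add_left, fun_iteratedFDeriv_sub_apply (hadd x).contDiffAt (hadd y).contDiffAt,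
    iteratedFDeriv_comp_add_left, iteratedFDeriv_comp_add_left] at key
  simpa using key

set_option maxSynthPendingDepth 4 in
/-- A function with bounded third derivative grows at most cubically. -/
theorem exists_norm_le_mul_one_add_pow_three {f : E → F} (hf : ContDiff ℝ 3 f) {K : ℝ}
    (hb : ∀ x, ‖iteratedFDeriv ℝ 3 f x‖ ≤ K) :
    ∃ A, 0 ≤ A ∧ ∀ x, ‖f x‖ ≤ A * (1 + ‖x‖) ^ 3 := by
  have hK : 0 ≤ K := (norm_nonneg _).trans (hb 0)
  have h1 := (hf.differentiable (by norm_num))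
  have h2 := ((contDiff_two_fderiv hf).differentiable (by norm_num))
  have h3 := ((contDiff_one_fderiv_fderiv hf).differentiable (by norm_num))
  have g3 := norm_le_mul_one_add_pow_of_norm_fderiv_le h3 hK (n := 0) fun w => by
    rw [norm_fderiv_three_eq_norm_iteratedFDeriv]; simpa using hb w
  have g2 := norm_le_mul_one_add_pow_of_norm_fderiv_le h2 (by positivity) g3
  have g1 := norm_le_mul_one_add_pow_of_norm_fderiv_le h1 (by positivity) g2
  exact ⟨_, by positivity, g1⟩

set_option maxSynthPendingDepth 4 in
/-- The central second-order Taylor expansion of the derivative is accurate to third order. -/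
theorem norm_fderiv_central_sub_le {f : E → F} (hf : ContDiff ℝ 3 f) {M : ℝ} (hM : 0 ≤ M)
    (hL : ∀ x y, ‖iteratedFDeriv ℝ 3 f x - iteratedFDeriv ℝ 3 f y‖ ≤ M * ‖x - y‖) (θ w : E) :
    ‖fderiv ℝ f (θ + w) - fderiv ℝ f (θ - w) - (2 : ℝ) • fderiv ℝ (fderiv ℝ f) θ w‖ ≤
      2 * M * ‖w‖ ^ 3 := by
  have h2 := ((contDiff_two_fderiv hf).differentiable (by norm_num))
  have h3 := ((contDiff_one_fderiv_fderiv hf).differentiable (by norm_num))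
  have hg : ∀ w, HasFDerivAt
      (fun w => fderiv ℝ f (θ + w) - fderiv ℝ f (θ - w) - (2 : ℝ) • fderiv ℝ (fderiv ℝ f) θ w)
      (fderiv ℝ (fderiv ℝ f) (θ + w) + fderiv ℝ (fderiv ℝ f) (θ - w) -
        (2 : ℝ) • fderiv ℝ (fderiv ℝ f) θ) w := fun w => by
    have a := (h2 (θ + w)).hasFDerivAt.comp w ((hasFDerivAt_id w).const_add θ)
    have b := (h2 (θ - w)).hasFDerivAt.comp w ((hasFDerivAt_id w).const_sub θ)
    have c := ((fderiv ℝ (fderiv ℝ f) θ).hasFDerivAt (x := w)).const_smul (2 : ℝ)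
    refine ((a.sub b).sub c).congr_fderiv ?_
    ext; simp
  have hh : ∀ w, HasFDerivAt
      (fun w => fderiv ℝ (fderiv ℝ f) (θ + w) + fderiv ℝ (fderiv ℝ f) (θ - w) -
        (2 : ℝ) • fderiv ℝ (fderiv ℝ f) θ)
      (fderiv ℝ (fderiv ℝ (fderiv ℝ f)) (θ + w) - fderiv ℝ (fderiv ℝ (fderiv ℝ f)) (θ - w)) w :=
    fun w => by
    have a := (h3 (θ + w)).hasFDerivAt.comp w ((hasFDerivAt_id w).const_add θ)
    have b := (h3 (θ - w)).hasFDerivAt.comp w ((hasFDerivAt_id w).const_sub θ)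
    refine ((a.add b).sub_const ((2 : ℝ) • fderiv ℝ (fderiv ℝ f) θ)).congr_fderiv ?_
    ext; simp [sub_eq_add_neg]
  have bh := norm_le_mul_pow_of_norm_fderiv_le (fun w => (hh w).differentiableAt)
    (by simp [two_smul]) (K := 2 * M) (by positivity) (n := 1) fun w => by
      rw [(hh w).fderiv, norm_fderiv_three_sub_eq hf]
      refine (hL _ _).trans_eq ?_
      rw [show θ + w - (θ - w) = (2 : ℝ) • w by rw [two_smul]; abel, norm_smul]
      simp; ring
  exact norm_le_mul_pow_of_norm_fderiv_le (fun w => (hg w).differentiableAt)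
    (by simp) (K := 2 * M) (by positivity) (n := 2) (fun w => by
      rw [(hg w).fderiv]; exact bh w) w

/-- The symmetric mixed second difference approximates the second derivative. -/
theorem norm_mixed_difference_sub_le {f : E → F} (hf : ContDiff ℝ 3 f) {M : ℝ} (hM : 0 ≤ M)
    (hL : ∀ x y, ‖iteratedFDeriv ℝ 3 f x - iteratedFDeriv ℝ 3 f y‖ ≤ M * ‖x - y‖) (θ u v : E) :
    ‖f (θ + u + v) - f (θ - u + v) - f (θ + u - v) + f (θ - u - v) -
        (4 : ℝ) • fderiv ℝ (fderiv ℝ f) θ u v‖ ≤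
      4 * M * (‖u‖ + ‖v‖) ^ 3 * ‖v‖ := by
  have h1 := (hf.differentiable (by norm_num))
  have hk : ∀ v, HasFDerivAt
      (fun v => f (θ + u + v) - f (θ - u + v) - f (θ + u - v) + f (θ - u - v) -
        (4 : ℝ) • fderiv ℝ (fderiv ℝ f) θ u v)
      ((fderiv ℝ f (θ + (u + v)) - fderiv ℝ f (θ - (u + v))
          - (2 : ℝ) • fderiv ℝ (fderiv ℝ f) θ (u + v)) +
        (fderiv ℝ f (θ + (u - v)) - fderiv ℝ f (θ - (u - v))
          - (2 : ℝ) • fderiv ℝ (fderiv ℝ f) θ (u - v))) v := fun v => by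
    have a := (h1 (θ + u + v)).hasFDerivAt.comp v ((hasFDerivAt_id v).const_add (θ + u))
    have b := (h1 (θ - u + v)).hasFDerivAt.comp v ((hasFDerivAt_id v).const_add (θ - u))
    have c := (h1 (θ + u - v)).hasFDerivAt.comp v ((hasFDerivAt_id v).const_sub (θ + u))
    have d := (h1 (θ - u - v)).hasFDerivAt.comp v ((hasFDerivAt_id v).const_sub (θ - u))
    have e := ((fderiv ℝ (fderiv ℝ f) θ u).hasFDerivAt (x := v)).const_smul (4 : ℝ)
    refine ((((a.sub b).sub c).add d).sub e).congr_fderiv ?_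
    rw [show θ + (u + v) = θ + u + v by abel, show θ - (u + v) = θ - u - v by abel,
      show θ + (u - v) = θ + u - v by abel, show θ - (u - v) = θ - u + v by abel, map_add, map_sub]
    ext z
    simp
    module
  have hbound : ∀ x ∈ Metric.closedBall (0 : E) ‖v‖, ∀ s : E, ‖s‖ ≤ ‖u‖ + ‖x‖ →
      ‖fderiv ℝ f (θ + s) - fderiv ℝ f (θ - s) - (2 : ℝ) • fderiv ℝ (fderiv ℝ f) θ s‖ ≤
        2 * M * (‖u‖ + ‖v‖) ^ 3 := fun x hx s hs => by
    have hx : ‖x‖ ≤ ‖v‖ := by simpa using hx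
    refine (norm_fderiv_central_sub_le hf hM hL θ s).trans ?_
    have : ‖s‖ ≤ ‖u‖ + ‖v‖ := by linarith
    gcongr
  have h := (convex_closedBall (0 : E) ‖v‖).norm_image_sub_le_of_norm_hasFDerivWithin_le
    (C := 4 * M * (‖u‖ + ‖v‖) ^ 3) (x := 0) (y := v) (fun x _ => (hk x).hasFDerivWithinAt)
    (fun x hx => (norm_add_le _ _).trans (by
      linarith [hbound x hx (u + x) (norm_add_le _ _), hbound x hx (u - x) (norm_sub_le _ _)]))
    (by simp) (by simp)
  simpa using h

end Taylor

section Moments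

open scoped RealInnerProductSpace

theorem integral_smul_eq_zero_of_condExp_eq_zero {Ω G : Type*} {m m0 : MeasurableSpace Ω}
    (hm : m ≤ m0) {μ : Measure Ω} [IsFiniteMeasure μ] [NormedAddCommGroup G] [NormedSpace ℝ G]
    [CompleteSpace G] {ε : Ω → ℝ} {g : Ω → G} (hg : StronglyMeasurable[m] g)
    (hε : Integrable ε μ) (hεg : Integrable (fun ω => ε ω • g ω) μ) (h0 : μ[ε|m] =ᵐ[μ] 0) :
    ∫ ω, ε ω • g ω ∂μ = 0 := by
  have h := condExp_bilin_of_stronglyMeasurable_right (ContinuousLinearMap.lsmul ℝ ℝ) hg hεg hε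
  simp only [ContinuousLinearMap.lsmul_apply] at h
  rw [← integral_condExp hm, integral_congr_ae h]
  refine integral_eq_zero_of_ae ?_
  filter_upwards [h0] with ω hω
  simp [hω]

theorem integral_inner_smul_eq_self {Ω : Type*} {m0 : MeasurableSpace Ω} {μ : Measure Ω} {d : ℕ}
    {X Y : Ω → EuclideanSpace ℝ (Fin d)}
    (hint : ∀ i j : Fin d, Integrable (fun ω => Y ω i * X ω j) μ)
    (hid : ∀ i j : Fin d, ∫ ω, Y ω i * X ω j ∂μ = if i = j then (1 : ℝ) else 0)
    (v : EuclideanSpace ℝ (Fin d)) (hv : Integrable (fun ω => ⟪Y ω, v⟫ • X ω) μ) :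
    ∫ ω, ⟪Y ω, v⟫ • X ω ∂μ = v := by
  ext j
  have h := (EuclideanSpace.proj j : EuclideanSpace ℝ (Fin d) →L[ℝ] ℝ).integral_comp_comm hv
  refine h.symm.trans ?_
  have e : ∀ ω, (EuclideanSpace.proj j : EuclideanSpace ℝ (Fin d) →L[ℝ] ℝ) (⟪Y ω, v⟫ • X ω) =
      ∑ i, v i * (Y ω i * X ω j) := fun ω => by
    change (⟪Y ω, v⟫ • X ω) j = _
    simp only [PiLp.smul_apply, smul_eq_mul, PiLp.inner_apply, Finset.sum_mul]
    refine Finset.sum_congr rfl fun i _ => ?_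
    simp [mul_assoc]
  simp_rw [e]
  rw [integral_finsetSum _ fun i _ => (hint i j).const_mul _]
  simp [integral_const_mul, hid]

theorem abs_mixed_difference_le {E : Type*} [NormedAddCommGroup E] [NormedSpace ℝ E]
    {f : E → ℝ} {A : ℝ} (hA : 0 ≤ A) (hf : ∀ x, ‖f x‖ ≤ A * (1 + ‖x‖) ^ 3)
    (θ x y : E) {c ct : ℝ} (hc : 0 ≤ c) (hct : 0 ≤ ct) :
    |f (θ + c • x + ct • y) - f (θ + c • x) - f (θ - c • x + ct • y) + f (θ - c • x)| ≤
      4 * A * (1 + ‖θ‖ + c + ct) ^ 3 * ((1 + ‖x‖) ^ 3 * (1 + ‖y‖) ^ 3) := by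
  have key : ∀ z : E, ‖z‖ ≤ ‖θ‖ + c * ‖x‖ + ct * ‖y‖ →
      |f z| ≤ A * (1 + ‖θ‖ + c + ct) ^ 3 * ((1 + ‖x‖) ^ 3 * (1 + ‖y‖) ^ 3) := fun z hz => by
    have hx := norm_nonneg x
    have hy := norm_nonneg y
    have hθ := norm_nonneg θ
    have h : 1 + ‖z‖ ≤ (1 + ‖θ‖ + c + ct) * ((1 + ‖x‖) * (1 + ‖y‖)) := by
      have : 0 ≤ ‖x‖ * ‖y‖ := by positivity
      have : 0 ≤ (1 + ‖θ‖ + c + ct) * (‖x‖ * ‖y‖) := by positivity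
      have : 0 ≤ (1 + ‖θ‖ + ct) * ‖x‖ := by positivity
      have : 0 ≤ (1 + ‖θ‖ + c) * ‖y‖ := by positivity
      linarith
    calc |f z| ≤ A * (1 + ‖z‖) ^ 3 := hf z
      _ ≤ A * ((1 + ‖θ‖ + c + ct) * ((1 + ‖x‖) * (1 + ‖y‖))) ^ 3 := by gcongr
      _ = _ := by ring
  have hcx : ‖c • x‖ = c * ‖x‖ := by rw [norm_smul, Real.norm_of_nonneg hc]
  have hcy : ‖ct • y‖ = ct * ‖y‖ := by rw [norm_smul, Real.norm_of_nonneg hct]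
  have hy : 0 ≤ ct * ‖y‖ := by positivity
  have n1 := norm_add_le θ (c • x)
  have n2 := norm_sub_le θ (c • x)
  have k1 := abs_le.1 (key (θ + c • x + ct • y)
    (by linarith [norm_add_le (θ + c • x) (ct • y)]))
  have k2 := abs_le.1 (key (θ + c • x) (by linarith))
  have k3 := abs_le.1 (key (θ - c • x + ct • y)
    (by linarith [norm_add_le (θ - c • x) (ct • y)]))
  have k4 := abs_le.1 (key (θ - c • x) (by linarith))
  rw [abs_le]
  constructor <;> linarith [k1.1, k1.2, k2.1, k2.2, k3.1, k3.2, k4.1, k4.2]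

variable {E : Type*} [NormedAddCommGroup E] [InnerProductSpace ℝ E]

theorem add_div_smul_sub_div_smul {V : Type*} [AddCommGroup V] [Module ℝ V] (N e k : ℝ) (T : V) :
    ((N + e) / k) • T - (N / k) • T = e • k⁻¹ • T := by
  rw [← sub_smul, smul_smul]
  congr 1
  ring

theorem norm_innerSL_smulRight (a b : E) : ‖(innerSL ℝ a).smulRight b‖ = ‖a‖ * ‖b‖ := by
  rw [ContinuousLinearMap.norm_smulRight_apply, innerSL_apply_norm]

theorem continuous_innerSL_smulRight :
    Continuous fun p : E × E => (innerSL ℝ p.1).smulRight p.2 := by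
  have : (fun p : E × E => (innerSL ℝ p.1).smulRight p.2) = fun p : E × E =>
      ContinuousLinearMap.smulRightL ℝ E E (innerSL ℝ p.1) p.2 := rfl
  rw [this]
  fun_prop

theorem inner_fderiv_gradient [CompleteSpace E] {f : E → ℝ} {θ : E}
    (hf : DifferentiableAt ℝ (fderiv ℝ f) θ) (v w : E) :
    ⟪fderiv ℝ (gradient f) θ v, w⟫ = fderiv ℝ (fderiv ℝ f) θ v w := by
  let T : StrongDual ℝ E →L[ℝ] E :=
    { toFun := (InnerProductSpace.toDual ℝ E).symm
      map_add' := map_add _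
      map_smul' := fun c x => by simp
      cont := (InnerProductSpace.toDual ℝ E).symm.continuous }
  have h : HasFDerivAt (gradient f) (T ∘L fderiv ℝ (fderiv ℝ f) θ) θ :=
    T.hasFDerivAt.comp θ hf.hasFDerivAt
  rw [h.fderiv]
  exact InnerProductSpace.toDual_symm_apply

variable [FiniteDimensional ℝ E] [MeasurableSpace E] [BorelSpace E]

theorem stronglyMeasurable_smul_innerSL_smulRight {Ω : Type*} {m : MeasurableSpace Ω}
    {a b : Ω → E} (ha : Measurable a) (hb : Measurable b) (k : ℝ) :
    StronglyMeasurable fun ω => k • (innerSL ℝ (a ω)).smulRight (b ω) :=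
  (continuous_innerSL_smulRight.comp_stronglyMeasurable
    (ha.prodMk hb).stronglyMeasurable).const_smul k

theorem integrable_inner_smul {φ : E → E} (hφ : Measurable φ) {ρ : Measure E}
    (h : Integrable (fun x => ‖x‖ * ‖φ x‖) ρ) (v : E) : Integrable (fun x => ⟪φ x, v⟫ • x) ρ := by
  refine (h.const_mul ‖v‖).mono' (by fun_prop) (ae_of_all _ fun x => ?_)
  rw [norm_smul]
  have := norm_inner_le_norm (𝕜 := ℝ) (φ x) v
  calc ‖⟪φ x, v⟫‖ * ‖x‖ ≤ ‖φ x‖ * ‖v‖ * ‖x‖ := by gcongr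
    _ = _ := by ring

theorem integrable_bilin_smul_innerSL_smulRight {φ : E → E} (hφ : Measurable φ)
    {ρ σ : Measure E} [SFinite ρ] [SFinite σ]
    (hρ : Integrable (fun x => ‖x‖ * ‖φ x‖) ρ) (hσ : Integrable (fun x => ‖x‖ * ‖φ x‖) σ)
    (B : E →L[ℝ] E →L[ℝ] ℝ) :
    Integrable (fun p : E × E => B p.1 p.2 • (innerSL ℝ (φ p.1)).smulRight (φ p.2))
      (ρ.prod σ) := by
  refine ((hρ.mul_prod hσ).const_mul ‖B‖).mono' ?_ (ae_of_all _ fun p => ?_)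
  · have hT : Measurable fun p : E × E => (innerSL ℝ (φ p.1)).smulRight (φ p.2) :=
      continuous_innerSL_smulRight.measurable.comp
        ((hφ.comp measurable_fst).prodMk (hφ.comp measurable_snd))
    have hB : Continuous fun p : E × E => B p.1 p.2 := by fun_prop
    exact (hB.measurable.smul hT).aestronglyMeasurable
  · rw [norm_smul, norm_innerSL_smulRight]
    calc ‖B p.1 p.2‖ * (‖φ p.1‖ * ‖φ p.2‖) ≤ ‖B‖ * ‖p.1‖ * ‖p.2‖ * (‖φ p.1‖ * ‖φ p.2‖) := by
          gcongr
          exact B.le_opNorm₂ _ _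
      _ = _ := by ring

/-- A bilinear form is recovered from its isotropic random probes. -/
theorem integral_bilin_smul_innerSL_smulRight {φ : E → E} (hφ : Measurable φ)
    {ρ σ : Measure E} [SFinite ρ] [SFinite σ]
    (hρ : Integrable (fun x => ‖x‖ * ‖φ x‖) ρ) (hσ : Integrable (fun x => ‖x‖ * ‖φ x‖) σ)
    (hρI : ∀ v, ∫ x, ⟪φ x, v⟫ • x ∂ρ = v) (hσI : ∀ v, ∫ x, ⟪φ x, v⟫ • x ∂σ = v)
    (B : E →L[ℝ] E →L[ℝ] ℝ) {A : E →L[ℝ] E} (hA : ∀ v w, ⟪A v, w⟫ = B v w) :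
    ∫ p, B p.1 p.2 • (innerSL ℝ (φ p.1)).smulRight (φ p.2) ∂(ρ.prod σ) = A := by
  refine ContinuousLinearMap.ext fun v => ext_inner_right ℝ fun w => ?_
  let S : (E →L[ℝ] E) →L[ℝ] ℝ := innerSL ℝ w ∘L ContinuousLinearMap.apply ℝ E v
  have hS : ∀ T : E →L[ℝ] E, S T = ⟪T v, w⟫ := fun T => real_inner_comm _ _
  rw [← hS, ← S.integral_comp_comm (integrable_bilin_smul_innerSL_smulRight hφ hρ hσ B), hA]
  have h := integral_prod_bilin (μ := ρ) (ν := σ) B (integrable_inner_smul hφ hρ v)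
    (integrable_inner_smul hφ hσ w)
  rw [hρI, hσI] at h
  rw [← h]
  refine integral_congr_ae (ae_of_all _ fun p => ?_)
  simp only [hS, map_smul, smul_eq_mul, _root_.smul_apply,
    ContinuousLinearMap.smulRight_apply, innerSL_apply_apply, real_inner_smul_left]
  ring

end Moments

section Bias

open scoped RealInnerProductSpace

theorem integrable_one_add_norm_pow_three_mul {E : Type*} [NormedAddCommGroup E]
    [MeasurableSpace E] {φ : E → E} {ρ : Measure E}
    (hm : ∀ j : ℕ, j ≤ 4 → Integrable (fun x => ‖x‖ ^ j * ‖φ x‖) ρ) :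
    Integrable (fun x => (1 + ‖x‖) ^ 3 * ‖φ x‖) ρ := by
  have h := (((hm 0 (by norm_num)).add ((hm 1 (by norm_num)).const_mul 3)).add
    ((hm 2 (by norm_num)).const_mul 3)).add (hm 3 (by norm_num))
  refine h.congr (ae_of_all _ fun x => ?_)
  simp only [Pi.add_apply]
  ring

variable {E : Type*} [NormedAddCommGroup E] [InnerProductSpace ℝ E]

theorem norm_symmetrized_estimator_sub_le {f : E → ℝ} (hf : ContDiff ℝ 3 f) {M κ : ℝ}
    (hM : 0 ≤ M) (hκ : 0 < κ)
    (hL : ∀ x y, ‖iteratedFDeriv ℝ 3 f x - iteratedFDeriv ℝ 3 f y‖ ≤ M * ‖x - y‖)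
    (θ x y : E) {c ct : ℝ} (hc : 0 < c) (hct : 0 < ct) (hcκ : ct ≤ κ * c) :
    |(f (θ + c • x + ct • y) - f (θ - c • x + ct • y) - f (θ + c • x - ct • y)
        + f (θ - c • x - ct • y)) / (4 * c * ct) - fderiv ℝ (fderiv ℝ f) θ x y| ≤
      4 * M * c ^ 2 * (‖x‖ ^ 3 * ‖y‖ + κ ^ 3 * ‖y‖ ^ 4) := by
  have h := norm_mixed_difference_sub_le hf hM hL θ (c • x) (ct • y)
  rw [Real.norm_eq_abs, norm_smul, norm_smul, Real.norm_of_nonneg hc.le,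
    Real.norm_of_nonneg hct.le] at h
  simp only [map_smul, _root_.smul_apply, smul_eq_mul] at h
  have hpos : 0 < 4 * c * ct := by positivity
  have hcub : (c * ‖x‖ + ct * ‖y‖) ^ 3 ≤ 4 * c ^ 3 * (‖x‖ ^ 3 + κ ^ 3 * ‖y‖ ^ 3) :=
    calc (c * ‖x‖ + ct * ‖y‖) ^ 3 ≤ (c * ‖x‖ + κ * c * ‖y‖) ^ 3 := by gcongr
      _ = c ^ 3 * (‖x‖ + κ * ‖y‖) ^ 3 := by ring
      _ ≤ c ^ 3 * (2 ^ (3 - 1) * (‖x‖ ^ 3 + (κ * ‖y‖) ^ 3)) := by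
          gcongr
          exact add_pow_le (by positivity) (by positivity) 3
      _ = _ := by norm_num; ring
  have e : ∀ N B : ℝ, N / (4 * c * ct) - B = (N - 4 * (c * (ct * B))) / (4 * c * ct) :=
    fun N B => by field_simp
  rw [e, abs_div, abs_of_pos hpos, div_le_iff₀ hpos]
  have e2 : ∀ B : ℝ, 4 * (ct * (c * B)) = 4 * (c * (ct * B)) := fun B => by ring
  simp only [e2] at h
  calc _ ≤ 4 * M * (c * ‖x‖ + ct * ‖y‖) ^ 3 * (ct * ‖y‖) := h
    _ ≤ 4 * M * (4 * c ^ 3 * (‖x‖ ^ 3 + κ ^ 3 * ‖y‖ ^ 3)) * (ct * ‖y‖) := by gcongr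
    _ = _ := by ring

variable [FiniteDimensional ℝ E] [MeasurableSpace E] [BorelSpace E]

theorem integrable_mixed_difference_smul {f : E → ℝ} (hf : Continuous f)
    {A : ℝ} (hA : 0 ≤ A) (hfA : ∀ x, ‖f x‖ ≤ A * (1 + ‖x‖) ^ 3)
    {φ : E → E} (hφ : Measurable φ) {ρ σ : Measure E} [SFinite ρ] [SFinite σ]
    (hρ : ∀ j : ℕ, j ≤ 4 → Integrable (fun x => ‖x‖ ^ j * ‖φ x‖) ρ)
    (hσ : ∀ j : ℕ, j ≤ 4 → Integrable (fun x => ‖x‖ ^ j * ‖φ x‖) σ)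
    (θ : E) {c ct : ℝ} (hc : 0 < c) (hct : 0 < ct) :
    Integrable (fun p : E × E =>
      ((f (θ + c • p.1 + ct • p.2) - f (θ + c • p.1) - f (θ - c • p.1 + ct • p.2)
        + f (θ - c • p.1)) / (2 * c * ct)) • (innerSL ℝ (φ p.1)).smulRight (φ p.2))
      (ρ.prod σ) := by
  refine ((((integrable_one_add_norm_pow_three_mul hρ).mul_prod
    (integrable_one_add_norm_pow_three_mul hσ)).const_mul
      (4 * A * (1 + ‖θ‖ + c + ct) ^ 3)).div_const (2 * c * ct)).mono' ?_ (ae_of_all _ fun p => ?_)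
  · have hT : Measurable fun p : E × E => (innerSL ℝ (φ p.1)).smulRight (φ p.2) :=
      continuous_innerSL_smulRight.measurable.comp
        ((hφ.comp measurable_fst).prodMk (hφ.comp measurable_snd))
    have hN : Continuous fun p : E × E =>
        (f (θ + c • p.1 + ct • p.2) - f (θ + c • p.1) - f (θ - c • p.1 + ct • p.2)
          + f (θ - c • p.1)) / (2 * c * ct) := by fun_prop
    exact (hN.measurable.smul hT).aestronglyMeasurable
  · rw [norm_smul, norm_innerSL_smulRight, norm_div, Real.norm_eq_abs, Real.norm_eq_abs,
      abs_of_pos (by positivity : 0 < 2 * c * ct), div_mul_eq_mul_div]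
    refine div_le_div_of_nonneg_right ?_ (by positivity)
    calc _ ≤ 4 * A * (1 + ‖θ‖ + c + ct) ^ 3 * ((1 + ‖p.1‖) ^ 3 * (1 + ‖p.2‖) ^ 3) *
          (‖φ p.1‖ * ‖φ p.2‖) := by
          gcongr
          exact abs_mixed_difference_le hA hfA θ p.1 p.2 hc.le hct.le
      _ = _ := by ring

theorem norm_integral_estimator_sub_le {f : E → ℝ} (hf : ContDiff ℝ 3 f) {M κ D₂ : ℝ}
    (hM : 0 ≤ M) (hκ : 0 < κ)
    (hL : ∀ x y, ‖iteratedFDeriv ℝ 3 f x - iteratedFDeriv ℝ 3 f y‖ ≤ M * ‖x - y‖)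
    {φ : E → E} (hφ : Measurable φ) (hodd : ∀ x, φ (-x) = -φ x)
    {ρ σ : Measure E} [SFinite ρ] [SFinite σ] (hσsymm : MeasurePreserving Neg.neg σ σ)
    (hρ : ∀ j : ℕ, j ≤ 4 → Integrable (fun x => ‖x‖ ^ j * ‖φ x‖) ρ)
    (hσ : ∀ j : ℕ, j ≤ 4 → Integrable (fun x => ‖x‖ ^ j * ‖φ x‖) σ)
    (hρD : ∀ j : ℕ, j ≤ 4 → ∫ x, ‖x‖ ^ j * ‖φ x‖ ∂ρ ≤ D₂)
    (hσD : ∀ j : ℕ, j ≤ 4 → ∫ x, ‖x‖ ^ j * ‖φ x‖ ∂σ ≤ D₂)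
    (hρI : ∀ v, ∫ x, ⟪φ x, v⟫ • x ∂ρ = v) (hσI : ∀ v, ∫ x, ⟪φ x, v⟫ • x ∂σ = v)
    (θ : E) {c ct : ℝ} (hc : 0 < c) (hct : 0 < ct) (hcκ : ct ≤ κ * c)
    (hG : Integrable (fun p : E × E =>
      ((f (θ + c • p.1 + ct • p.2) - f (θ + c • p.1) - f (θ - c • p.1 + ct • p.2)
        + f (θ - c • p.1)) / (2 * c * ct)) • (innerSL ℝ (φ p.1)).smulRight (φ p.2))
      (ρ.prod σ)) :
    ‖(∫ p : E × E,
      ((f (θ + c • p.1 + ct • p.2) - f (θ + c • p.1) - f (θ - c • p.1 + ct • p.2)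
        + f (θ - c • p.1)) / (2 * c * ct)) • (innerSL ℝ (φ p.1)).smulRight (φ p.2)
      ∂(ρ.prod σ)) - fderiv ℝ (gradient f) θ‖ ≤ 4 * M * (1 + κ ^ 3) * D₂ ^ 2 * c ^ 2 := by
  set G : E × E → E →L[ℝ] E := fun p =>
    ((f (θ + c • p.1 + ct • p.2) - f (θ + c • p.1) - f (θ - c • p.1 + ct • p.2)
        + f (θ - c • p.1)) / (2 * c * ct)) • (innerSL ℝ (φ p.1)).smulRight (φ p.2) with hGdef
  set B := fderiv ℝ (fderiv ℝ f) θ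
  have hr : MeasurePreserving (Prod.map id Neg.neg) (ρ.prod σ) (ρ.prod σ) :=
    (MeasurePreserving.id ρ).prod hσsymm
  have hGr : Integrable (fun p => G (Prod.map id Neg.neg p)) (ρ.prod σ) :=
    hr.integrable_comp_of_integrable hG
  have hGri : ∫ p, G (Prod.map id Neg.neg p) ∂(ρ.prod σ) = ∫ p, G p ∂(ρ.prod σ) := by
    have h := integral_map hr.measurable.aemeasurable (f := G)
      (by rw [hr.map_eq]; exact hG.aestronglyMeasurable)
    rw [← h, hr.map_eq]
  have hρ1 : Integrable (fun x => ‖x‖ * ‖φ x‖) ρ := by simpa using hρ 1 (by norm_num)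
  have hσ1 : Integrable (fun x => ‖x‖ * ‖φ x‖) σ := by simpa using hσ 1 (by norm_num)
  have hB := integral_bilin_smul_innerSL_smulRight hφ hρ1 hσ1 hρI hσI B
    (inner_fderiv_gradient ((contDiff_two_fderiv hf).differentiable (by norm_num) θ))
  have hBi := integrable_bilin_smul_innerSL_smulRight hφ hρ1 hσ1 B
  have hsym : ∀ p, (2⁻¹ : ℝ) • (G p + G (Prod.map id Neg.neg p)) -
      B p.1 p.2 • (innerSL ℝ (φ p.1)).smulRight (φ p.2) =
      ((f (θ + c • p.1 + ct • p.2) - f (θ - c • p.1 + ct • p.2) - f (θ + c • p.1 - ct • p.2)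
        + f (θ - c • p.1 - ct • p.2)) / (4 * c * ct) - B p.1 p.2) •
        (innerSL ℝ (φ p.1)).smulRight (φ p.2) := fun p => by
    have hneg : (innerSL ℝ (φ p.1)).smulRight (-φ p.2) =
        -(innerSL ℝ (φ p.1)).smulRight (φ p.2) := by ext; simp
    simp only [hGdef, Prod.map_fst, Prod.map_snd, id_eq, hodd, hneg, smul_neg, ← sub_eq_add_neg,
      ← sub_smul, smul_smul]
    congr 1
    field_simp
    ring
  have hint : (∫ p, G p ∂(ρ.prod σ)) - fderiv ℝ (gradient f) θ =
      ∫ p : E × E, ((f (θ + c • p.1 + ct • p.2) - f (θ - c • p.1 + ct • p.2)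
        - f (θ + c • p.1 - ct • p.2) + f (θ - c • p.1 - ct • p.2)) / (4 * c * ct) - B p.1 p.2) •
        (innerSL ℝ (φ p.1)).smulRight (φ p.2) ∂(ρ.prod σ) := by
    rw [← hB]
    simp_rw [← hsym]
    have hs : Integrable (fun p => (2⁻¹ : ℝ) • (G p + G (Prod.map id Neg.neg p))) (ρ.prod σ) :=
      (hG.add hGr).smul (2⁻¹ : ℝ)
    rw [integral_sub hs hBi, integral_smul, integral_add hG hGr, hGri,
      ← two_smul ℝ, smul_smul]
    norm_num
  have hbd : Integrable (fun p : E × E => 4 * M * c ^ 2 *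
      ((‖p.1‖ ^ 3 * ‖φ p.1‖) * (‖p.2‖ ^ 1 * ‖φ p.2‖) +
        κ ^ 3 * ((‖p.1‖ ^ 0 * ‖φ p.1‖) * (‖p.2‖ ^ 4 * ‖φ p.2‖)))) (ρ.prod σ) :=
    (((hρ 3 (by norm_num)).mul_prod (hσ 1 (by norm_num))).add
      (((hρ 0 (by norm_num)).mul_prod (hσ 4 (by norm_num))).const_mul _)).const_mul _
  have hmul : ∀ i j : ℕ, i ≤ 4 → j ≤ 4 →
      ∫ p : E × E, (‖p.1‖ ^ i * ‖φ p.1‖) * (‖p.2‖ ^ j * ‖φ p.2‖) ∂(ρ.prod σ) ≤ D₂ ^ 2 :=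
    fun i j hi hj => by
      rw [integral_prod_mul (fun x => ‖x‖ ^ i * ‖φ x‖) (fun y => ‖y‖ ^ j * ‖φ y‖), sq]
      have h0 : ∀ (τ : Measure E) (k : ℕ), 0 ≤ ∫ x, ‖x‖ ^ k * ‖φ x‖ ∂τ := fun τ k =>
        integral_nonneg fun x => by positivity
      exact mul_le_mul (hρD i hi) (hσD j hj) (h0 _ _) ((h0 _ _).trans (hρD i hi))
  rw [hint]
  refine (norm_integral_le_of_norm_le hbd (ae_of_all _ fun p => ?_)).trans ?_
  · rw [norm_smul, norm_innerSL_smulRight]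
    calc _ ≤ 4 * M * c ^ 2 * (‖p.1‖ ^ 3 * ‖p.2‖ + κ ^ 3 * ‖p.2‖ ^ 4) * (‖φ p.1‖ * ‖φ p.2‖) := by
          gcongr
          exact norm_symmetrized_estimator_sub_le hf hM hκ hL θ p.1 p.2 hc hct hcκ
      _ = _ := by ring
  · rw [integral_const_mul, integral_add
      ((hρ 3 (by norm_num)).mul_prod (hσ 1 (by norm_num)))
      (((hρ 0 (by norm_num)).mul_prod (hσ 4 (by norm_num))).const_mul _), integral_const_mul]
    calc _ ≤ 4 * M * c ^ 2 * (D₂ ^ 2 + κ ^ 3 * D₂ ^ 2) := by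
          gcongr
          · exact hmul 3 1 (by norm_num) (by norm_num)
          · exact hmul 0 4 (by norm_num) (by norm_num)
      _ = _ := by ring

end Bias

/-- bias of the four-query Hessian estimator: there is a constant `C`,
depending only on `d`, `D₁`, `M`, `D₂` and `κ`, such that for every loss `L` with bounded
`M`-Lipschitz third derivative, every probability space carrying symmetric independent
perturbations `Δ, Δ̃` with an odd map `φ` satisfying the identity and moment conditions,
every conditionally-centered observation noise, every `θ`, every `0 < c ≤ 1` and every
`0 < c̃ ≤ κ c`, the four-query Hessian estimator `Ĥ(θ)` satisfies
`‖E[Ĥ(θ)] − ∇²L(θ)‖ ≤ C c²` in operator norm. -/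
theorem bias_bound_of_four_query_hessian_estimator
    (d : ℕ) (hd : 1 ≤ d)
    (D₁ M D₂ κ : ℝ) (hD₁ : 0 ≤ D₁) (hM : 0 ≤ M) (hD₂ : 0 ≤ D₂) (hκ : 0 < κ) :
    ∃ C : ℝ,
      ∀ L : EuclideanSpace ℝ (Fin d) → ℝ,
        ContDiff ℝ 3 L →
        (∀ x, ‖iteratedFDeriv ℝ 3 L x‖ ≤ D₁) →
        (∀ x y, ‖iteratedFDeriv ℝ 3 L x - iteratedFDeriv ℝ 3 L y‖ ≤ M * ‖x - y‖) →
      ∀ (Ω : Type) (m0 : MeasurableSpace Ω) (μ : Measure Ω), IsProbabilityMeasure μ →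
      ∀ Δ Δt : Ω → EuclideanSpace ℝ (Fin d), Measurable Δ → Measurable Δt →
        -- `Δ` and `Δ̃` are independent and each symmetrically distributed
        ProbabilityTheory.IndepFun Δ Δt μ →
        Measure.map Δ μ = Measure.map (fun ω => -(Δ ω)) μ →
        Measure.map Δt μ = Measure.map (fun ω => -(Δt ω)) μ →
      ∀ φ : EuclideanSpace ℝ (Fin d) → EuclideanSpace ℝ (Fin d), Measurable φ →
        -- `φ` odd, `E[φ(Δ)Δᵀ] = E[φ(Δ̃)Δ̃ᵀ] = I`
        (∀ x, φ (-x) = -(φ x)) →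
        (∀ i j : Fin d, Integrable (fun ω => φ (Δ ω) i * Δ ω j) μ) →
        (∀ i j : Fin d,
          ∫ ω, φ (Δ ω) i * Δ ω j ∂μ = if i = j then (1 : ℝ) else 0) →
        (∀ i j : Fin d, Integrable (fun ω => φ (Δt ω) i * Δt ω j) μ) →
        (∀ i j : Fin d,
          ∫ ω, φ (Δt ω) i * Δt ω j ∂μ = if i = j then (1 : ℝ) else 0) →
        -- moment bounds `E[‖Δ‖^j ‖φ(Δ)‖] ≤ D₂`, `E[‖Δ̃‖^j ‖φ(Δ̃)‖] ≤ D₂`, `j = 0,…,4`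
        (∀ j : ℕ, j ≤ 4 → Integrable (fun ω => ‖Δ ω‖ ^ j * ‖φ (Δ ω)‖) μ) →
        (∀ j : ℕ, j ≤ 4 → ∫ ω, ‖Δ ω‖ ^ j * ‖φ (Δ ω)‖ ∂μ ≤ D₂) →
        (∀ j : ℕ, j ≤ 4 → Integrable (fun ω => ‖Δt ω‖ ^ j * ‖φ (Δt ω)‖) μ) →
        (∀ j : ℕ, j ≤ 4 → ∫ ω, ‖Δt ω‖ ^ j * ‖φ (Δt ω)‖ ∂μ ≤ D₂) →
      -- observation noise with zero conditional mean given `(Δ, Δ̃)`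
      ∀ ε : Ω → ℝ, Integrable ε μ →
        μ[ε|(MeasurableSpace.comap Δ inferInstance) ⊔
            (MeasurableSpace.comap Δt inferInstance)] =ᵐ[μ] 0 →
      ∀ (θ : EuclideanSpace ℝ (Fin d)) (c ct : ℝ),
        0 < c → c ≤ 1 → 0 < ct → ct ≤ κ * c →
      ∀ Hhat : Ω → (EuclideanSpace ℝ (Fin d) →L[ℝ] EuclideanSpace ℝ (Fin d)),
        -- `Ĥ(θ) = (ℓ̄/(2cc̃)) φ(Δ̃)φ(Δ)ᵀ` with `ℓ̄` the noisy fourfold difference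
        (∀ ω, Hhat ω =
          ((L (θ + c • Δ ω + ct • Δt ω) - L (θ + c • Δ ω)
              - L (θ - c • Δ ω + ct • Δt ω) + L (θ - c • Δ ω) + ε ω) / (2 * c * ct)) •
            ((innerSL ℝ (φ (Δ ω))).smulRight (φ (Δt ω)))) →
        Integrable Hhat μ →
        ‖(∫ ω, Hhat ω ∂μ) - fderiv ℝ (gradient L) θ‖ ≤ C * c ^ 2 := by
  refine ⟨4 * M * (1 + κ ^ 3) * D₂ ^ 2, ?_⟩
  intro L hL hLD hLM Ω m0 μ hμ Δ Δt hΔ hΔt hind _ hsymm φ hφ hodd hi1 hI1 hi2 hI2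
    hm1 hD1 hm2 hD2 ε hε hε0 θ c ct hc _ hct hcκ Hhat hH hHi
  set ρ := Measure.map Δ μ
  set σ := Measure.map Δt μ
  have hρp : IsProbabilityMeasure ρ := Measure.isProbabilityMeasure_map hΔ.aemeasurable
  have hσp : IsProbabilityMeasure σ := Measure.isProbabilityMeasure_map hΔt.aemeasurable
  have hprod : Measure.map (fun ω => (Δ ω, Δt ω)) μ = ρ.prod σ :=
    (ProbabilityTheory.indepFun_iff_map_prod_eq_prod_map_map hΔ.aemeasurable
      hΔt.aemeasurable).1 hind
  have hpair : Measurable fun ω => (Δ ω, Δt ω) := hΔ.prodMk hΔt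
  have hmeas : ∀ (j : ℕ) (τ : Measure (EuclideanSpace ℝ (Fin d))),
      AEStronglyMeasurable (fun x => ‖x‖ ^ j * ‖φ x‖) τ := fun j τ => by fun_prop
  have hρm : ∀ j : ℕ, j ≤ 4 → Integrable (fun x => ‖x‖ ^ j * ‖φ x‖) ρ := fun j hj =>
    (integrable_map_measure (hmeas j _) hΔ.aemeasurable).2 (hm1 j hj)
  have hσm : ∀ j : ℕ, j ≤ 4 → Integrable (fun x => ‖x‖ ^ j * ‖φ x‖) σ := fun j hj =>
    (integrable_map_measure (hmeas j _) hΔt.aemeasurable).2 (hm2 j hj)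
  have hρD : ∀ j : ℕ, j ≤ 4 → ∫ x, ‖x‖ ^ j * ‖φ x‖ ∂ρ ≤ D₂ := fun j hj =>
    (integral_map hΔ.aemeasurable (hmeas j _)).trans_le (hD1 j hj)
  have hσD : ∀ j : ℕ, j ≤ 4 → ∫ x, ‖x‖ ^ j * ‖φ x‖ ∂σ ≤ D₂ := fun j hj =>
    (integral_map hΔt.aemeasurable (hmeas j _)).trans_le (hD2 j hj)
  have hρI : ∀ v : EuclideanSpace ℝ (Fin d), ∫ x, inner ℝ (φ x) v • x ∂ρ = v := fun v => by
    have hv := integrable_inner_smul hφ (by simpa using hρm 1 (by norm_num)) v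
    rw [integral_map hΔ.aemeasurable hv.aestronglyMeasurable]
    exact integral_inner_smul_eq_self hi1 hI1 v (hv.comp_measurable hΔ)
  have hσI : ∀ v : EuclideanSpace ℝ (Fin d), ∫ x, inner ℝ (φ x) v • x ∂σ = v := fun v => by
    have hv := integrable_inner_smul hφ (by simpa using hσm 1 (by norm_num)) v
    rw [integral_map hΔt.aemeasurable hv.aestronglyMeasurable]
    exact integral_inner_smul_eq_self hi2 hI2 v (hv.comp_measurable hΔt)
  have hσsymm : MeasurePreserving Neg.neg σ σ :=
    ⟨measurable_neg, by
      rw [Measure.map_map measurable_neg hΔt]; exact hsymm.symm⟩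
  obtain ⟨A, hA, hLA⟩ := exists_norm_le_mul_one_add_pow_three hL hLD
  have hG := integrable_mixed_difference_smul hL.continuous hA hLA hφ hρm hσm θ hc hct
  have hbias := norm_integral_estimator_sub_le hL hM hκ hLM hφ hodd hσsymm hρm hσm hρD hσD
    hρI hσI θ hc hct hcκ hG
  rw [← hprod] at hG hbias
  rw [integral_map hpair.aemeasurable hG.aestronglyMeasurable] at hbias
  have hGΩ := hG.comp_measurable hpair
  set g : Ω → (EuclideanSpace ℝ (Fin d) →L[ℝ] EuclideanSpace ℝ (Fin d)) := fun ω =>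
    (2 * c * ct)⁻¹ • (innerSL ℝ (φ (Δ ω))).smulRight (φ (Δt ω))
  have hsplit : ∀ ω, Hhat ω - ((L (θ + c • Δ ω + ct • Δt ω) - L (θ + c • Δ ω)
      - L (θ - c • Δ ω + ct • Δt ω) + L (θ - c • Δ ω)) / (2 * c * ct)) •
        (innerSL ℝ (φ (Δ ω))).smulRight (φ (Δt ω)) = ε ω • g ω := fun ω => by
    rw [hH]
    exact add_div_smul_sub_div_smul _ _ _ _
  have hεg : Integrable (fun ω => ε ω • g ω) μ :=
    (hHi.sub hGΩ).congr (ae_of_all _ hsplit)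
  have hm : MeasurableSpace.comap Δ inferInstance ⊔ MeasurableSpace.comap Δt inferInstance ≤ m0 :=
    sup_le hΔ.comap_le hΔt.comap_le
  have hΔ' : Measurable[MeasurableSpace.comap Δ inferInstance ⊔
      MeasurableSpace.comap Δt inferInstance] Δ :=
    (comap_measurable Δ).mono le_sup_left le_rfl
  have hΔt' : Measurable[MeasurableSpace.comap Δ inferInstance ⊔
      MeasurableSpace.comap Δt inferInstance] Δt :=
    (comap_measurable Δt).mono le_sup_right le_rfl
  have hg : StronglyMeasurable[MeasurableSpace.comap Δ inferInstance ⊔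
      MeasurableSpace.comap Δt inferInstance] g :=
    stronglyMeasurable_smul_innerSL_smulRight (hφ.comp hΔ') (hφ.comp hΔt') _
  have hzero := integral_smul_eq_zero_of_condExp_eq_zero hm hg hε hεg hε0
  have hdiff := (integral_sub hHi hGΩ).symm.trans
    ((integral_congr_ae (ae_of_all _ hsplit)).trans hzero)
  rw [sub_eq_zero.1 hdiff]
  exact hbias
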